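/- Let a₀ < a < b < b₀ be real numbers, let F : [a₀,b₀] → [a₀,b₀] be a continuous map with F([a,b]) ⊆ [a,b], and set f := F restricted to [a,b]. Suppose every F-invariant Borel probability measure on [a₀,b₀] is supported on [a,b] ∪ {a₀,b₀}. Let Φ : [a₀,b₀] → ℝ be continuous, set φ := Φ restricted to [a,b], and suppose Φ(a₀) ≤ Q(f,φ) and Φ(b₀) ≤ Q(f,φ). Then Q(F,Φ) = Q(f,φ). -/

import Mathlib

open MeasureTheory Set

/-- `μ` is a `g`-invariant Borel probability measure for the dynamical system
`g` restricted to `S` (the measure gives full mass to `S`). -/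
def IsInvProbOn (g : ℝ → ℝ) (S : Set ℝ) (μ : Measure ℝ) : Prop :=
  IsProbabilityMeasure μ ∧ μ S = 1 ∧
    ∀ B : Set ℝ, MeasurableSet B → μ (g ⁻¹' B ∩ S) = μ B

/-- The maximum ergodic average `Q(g, ψ)` of the system `g` restricted to `S`. -/
noncomputable def maxErgAvgOn (g : ℝ → ℝ) (S : Set ℝ) (ψ : ℝ → ℝ) : ℝ :=
  sSup {r : ℝ | ∃ μ : Measure ℝ, IsInvProbOn g S μ ∧ r = ∫ x, ψ x ∂μ}

theorem IsInvProbOn.dirac {g : ℝ → ℝ} {S : Set ℝ} {x : ℝ} (hxS : x ∈ S) (hx : g x = x) :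
    IsInvProbOn g S (Measure.dirac x) := by
  refine ⟨inferInstance, Measure.dirac_apply_of_mem hxS, fun B hB => ?_⟩
  by_cases hxB : x ∈ B
  · have hmem : x ∈ g ⁻¹' B ∩ S := ⟨by simpa [hx] using hxB, hxS⟩
    rw [Measure.dirac_apply_of_mem hxB, Measure.dirac_apply_of_mem hmem]
  · rw [Measure.dirac_apply' x hB, indicator_of_notMem hxB]
    have hsub : g ⁻¹' B ∩ S ⊆ {x}ᶜ := by
      rintro y ⟨hy, -⟩ rfl
      exact hxB (by simpa [hx] using hy)
    refine measure_mono_null hsub ?_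
    simp

theorem IsInvProbOn.ae_mem {g : ℝ → ℝ} {S : Set ℝ} {μ : Measure ℝ} (h : IsInvProbOn g S μ)
    (hS : MeasurableSet S) : ∀ᵐ x ∂μ, x ∈ S :=
  have := h.1
  (mem_ae_iff_prob_eq_one hS).2 h.2.1

theorem IsInvProbOn.mono {g : ℝ → ℝ} {S T : Set ℝ} {μ : Measure ℝ} (h : IsInvProbOn g S μ)
    (hS : MeasurableSet S) (hST : S ⊆ T) : IsInvProbOn g T μ := by
  have := h.1
  refine ⟨h.1, le_antisymm prob_le_one (h.2.1 ▸ measure_mono hST), fun B hB => ?_⟩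
  rw [← h.2.2 B hB]
  refine measure_congr ?_
  filter_upwards [h.ae_mem hS] with x hx
  exact propext ⟨fun h => ⟨h.1, hx⟩, fun h => ⟨h.1, hST hx⟩⟩

/-- An invariant measure conditioned on a forward invariant subset is invariant. -/
theorem IsInvProbOn.cond {g : ℝ → ℝ} {S T : Set ℝ} {μ : Measure ℝ} (h : IsInvProbOn g T μ)
    (hS : MeasurableSet S) (hST : S ⊆ T) (hg : MapsTo g S S) (hμS : μ S ≠ 0) :
    IsInvProbOn g S (ProbabilityTheory.cond μ S) := by
  have := h.1
  refine ⟨ProbabilityTheory.cond_isProbabilityMeasure hμS,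
    ProbabilityTheory.cond_apply_self hμS (measure_ne_top μ S), fun B hB => ?_⟩
  have hae : S =ᵐ[μ] (g ⁻¹' S ∩ T : Set ℝ) :=
    ae_eq_of_subset_of_measure_ge (fun x hx => ⟨hg hx, hST hx⟩) (h.2.2 S hS).le
      hS.nullMeasurableSet (measure_ne_top _ _)
  rw [ProbabilityTheory.cond_apply hS, ProbabilityTheory.cond_apply hS, ← h.2.2 _ (hS.inter hB)]
  congr 1
  refine measure_congr ?_
  filter_upwards [hae] with x hx
  have hx' : x ∈ S ↔ g x ∈ S ∧ x ∈ T := iff_of_eq hx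
  refine propext ⟨fun ⟨h1, h2, _⟩ => ⟨⟨hg h1, h2⟩, hST h1⟩, fun ⟨⟨h1, h2⟩, h3⟩ => ?_⟩
  exact ⟨hx'.2 ⟨h1, h3⟩, h2, hx'.2 ⟨h1, h3⟩⟩

theorem IsInvProbOn.integrable {g ψ : ℝ → ℝ} {S : Set ℝ} {μ : Measure ℝ} (h : IsInvProbOn g S μ)
    (hS : IsCompact S) (hψ : ContinuousOn ψ S) : Integrable ψ μ := by
  have := h.1
  have hi := hψ.integrableOn_compact (μ := μ) hS
  rwa [IntegrableOn, Measure.restrict_eq_self_of_ae_mem (h.ae_mem hS.measurableSet)] at hi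

theorem bddAbove_integral_isInvProbOn (g : ℝ → ℝ) {ψ : ℝ → ℝ} {S : Set ℝ} (hS : IsCompact S)
    (hψ : ContinuousOn ψ S) :
    BddAbove {r : ℝ | ∃ μ : Measure ℝ, IsInvProbOn g S μ ∧ r = ∫ x, ψ x ∂μ} := by
  obtain ⟨M, hM⟩ := hS.bddAbove_image hψ
  refine ⟨M, ?_⟩
  rintro r ⟨μ, hμ, rfl⟩
  have := hμ.1
  calc ∫ x, ψ x ∂μ ≤ ∫ _, M ∂μ := by
        refine integral_mono_ae (hμ.integrable hS hψ) (integrable_const M) ?_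
        filter_upwards [hμ.ae_mem hS.measurableSet] with x hx using hM ⟨x, hx, rfl⟩
    _ = M := by simp

theorem IsInvProbOn.integral_le_maxErgAvgOn {g ψ : ℝ → ℝ} {S : Set ℝ} {μ : Measure ℝ}
    (h : IsInvProbOn g S μ) (hS : IsCompact S) (hψ : ContinuousOn ψ S) :
    ∫ x, ψ x ∂μ ≤ maxErgAvgOn g S ψ :=
  le_csSup (bddAbove_integral_isInvProbOn g hS hψ) ⟨μ, h, rfl⟩

/-- On a compact forward invariant subset, the integral against an invariant measure is at most
the maximum ergodic average of the subsystem times the mass of the subset. -/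
theorem IsInvProbOn.setIntegral_le {g ψ : ℝ → ℝ} {S T : Set ℝ} {μ : Measure ℝ}
    (h : IsInvProbOn g T μ) (hS : IsCompact S) (hST : S ⊆ T) (hg : MapsTo g S S)
    (hψ : ContinuousOn ψ S) :
    ∫ x in S, ψ x ∂μ ≤ μ.real S * maxErgAvgOn g S ψ := by
  have := h.1
  by_cases hμS : μ S = 0
  · simp [Measure.restrict_eq_zero.2 hμS, measureReal_def, hμS]
  have hle := (h.cond hS.measurableSet hST hg hμS).integral_le_maxErgAvgOn hS hψ
  have hpos : 0 < μ.real S := ENNReal.toReal_pos hμS (measure_ne_top μ S)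
  rw [ProbabilityTheory.cond, integral_smul_measure, ENNReal.toReal_inv, smul_eq_mul,
    ← measureReal_def, inv_mul_le_iff₀ hpos] at hle
  exact hle

/-- **The maximum ergodic average does not change under extension**, provided
the values of the potential at the new endpoints do not exceed the original
maximum ergodic average. Here `Q(f, φ)` is `maxErgAvgOn F (Icc a b) Φ` (the
system `f = F|_[a,b]` with potential `φ = Φ|_[a,b]`) and `Q(F, Φ)` is
`maxErgAvgOn F (Icc a₀ b₀) Φ`. -/
theorem maxErgAvg_extension_eq
    (a₀ a b b₀ : ℝ) (h0 : a₀ < a) (hab : a < b) (h1 : b < b₀)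
    (F : ℝ → ℝ) (hFc : ContinuousOn F (Icc a₀ b₀))
    (hFmaps : MapsTo F (Icc a₀ b₀) (Icc a₀ b₀))
    (hFM : MapsTo F (Icc a b) (Icc a b))
    (hsupp : ∀ μ : Measure ℝ, IsInvProbOn F (Icc a₀ b₀) μ → μ (Icc a b ∪ {a₀, b₀}) = 1)
    (Φ : ℝ → ℝ) (hΦ : ContinuousOn Φ (Icc a₀ b₀))
    (ha : Φ a₀ ≤ maxErgAvgOn F (Icc a b) Φ)
    (hb : Φ b₀ ≤ maxErgAvgOn F (Icc a b) Φ) :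
    maxErgAvgOn F (Icc a₀ b₀) Φ = maxErgAvgOn F (Icc a b) Φ := by
  have hsub : Icc a b ⊆ Icc a₀ b₀ := Icc_subset_Icc h0.le h1.le
  obtain ⟨c, hc, hFc'⟩ := exists_mem_Icc_isFixedPt_of_mapsTo (hFc.mono hsub) hab.le hFM
  have hdirac : IsInvProbOn F (Icc a b) (Measure.dirac c) := .dirac hc hFc'
  refine le_antisymm (csSup_le ⟨_, _, hdirac.mono measurableSet_Icc hsub, rfl⟩ ?_)
    (csSup_le ⟨_, _, hdirac, rfl⟩ ?_)
  · rintro r ⟨μ, hμ, rfl⟩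
    have := hμ.1
    set Q := maxErgAvgOn F (Icc a b) Φ
    have hE : MeasurableSet ({a₀, b₀} : Set ℝ) := (toFinite _).measurableSet
    have hdisj : Disjoint (Icc a b) {a₀, b₀} := by
      rw [disjoint_left]
      rintro x hx (rfl | rfl)
      · exact absurd hx.1 h0.not_ge
      · exact absurd hx.2 h1.not_ge
    have hint : Integrable Φ μ := hμ.integrable isCompact_Icc hΦ
    have hmass : μ.real (Icc a b) + μ.real {a₀, b₀} = 1 := by
      rw [← measureReal_union hdisj hE, measureReal_def, hsupp μ hμ, ENNReal.toReal_one]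
    have hendpoints : ∫ x in ({a₀, b₀} : Set ℝ), Φ x ∂μ ≤ μ.real {a₀, b₀} * Q := by
      calc ∫ x in ({a₀, b₀} : Set ℝ), Φ x ∂μ ≤ ∫ _ in ({a₀, b₀} : Set ℝ), Q ∂μ := by
            refine setIntegral_mono_on hint.integrableOn (integrable_const Q) hE ?_
            rintro x (rfl | rfl)
            exacts [ha, hb]
        _ = μ.real {a₀, b₀} * Q := by simp
    calc ∫ x, Φ x ∂μ = ∫ x in Icc a b ∪ {a₀, b₀}, Φ x ∂μ := by
          rw [Measure.restrict_eq_self_of_ae_mem (s := Icc a b ∪ {a₀, b₀})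
            ((mem_ae_iff_prob_eq_one (measurableSet_Icc.union hE)).2 (hsupp μ hμ))]
      _ = ∫ x in Icc a b, Φ x ∂μ + ∫ x in ({a₀, b₀} : Set ℝ), Φ x ∂μ :=
          setIntegral_union hdisj hE hint.integrableOn hint.integrableOn
      _ ≤ μ.real (Icc a b) * Q + μ.real {a₀, b₀} * Q :=
          add_le_add (hμ.setIntegral_le isCompact_Icc hsub hFM (hΦ.mono hsub)) hendpoints
      _ = Q := by rw [← add_mul, hmass, one_mul]
  · rintro r ⟨μ, hμ, rfl⟩
    exact (hμ.mono measurableSet_Icc hsub).integral_le_maxErgAvgOn isCompact_Icc hΦ
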